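/- For $t\ge 0$, $\eta\in\mathbb{S}^{2m+1}$, exponents $1<p<\infty$, $p'=p/(p-1)$, $0<\lambda<2(m+1)$, and $f$ integrable, define $f_{t,\eta}=f\circ\Phi_{t,\eta}\,\phi_{t,\eta}^{(m+1)/p}$. Then $I_\lambda(f_{t,\eta})=I_\lambda\big(f\,\phi_{t,-\eta}^{(m+1)/p'-\lambda/4}\big)\circ\Phi_{t,\eta}\cdot\phi_{t,\eta}^{\lambda/4}$, where $I_\lambda g(\xi)=\int_{\mathbb{S}^{2m+1}}|1-\xi\cdot\overline{\zeta}|^{-\lambda/2}g(\zeta)d\sigma(\zeta)$. -/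

import Mathlib

noncomputable section
open MeasureTheory Real

/-- Hermitian pairing `ξ · conj η` on `ℂ^{m+1}`. -/
def hdot {m : ℕ} (ξ η : EuclideanSpace ℂ (Fin (m + 1))) : ℂ :=
  ∑ i, ξ i * starRingEnd ℂ (η i)

instance {m : ℕ} : MeasurableSpace (EuclideanSpace ℂ (Fin (m + 1))) := borel _
instance {m : ℕ} : BorelSpace (EuclideanSpace ℂ (Fin (m + 1))) := ⟨rfl⟩
instance {m : ℕ} : MeasureSpace (EuclideanSpace ℂ (Fin (m + 1))) :=
  ⟨(Module.finBasis ℝ (EuclideanSpace ℂ (Fin (m + 1)))).addHaar⟩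

/-- The unit sphere `S^{2m+1} ⊆ ℂ^{m+1}`. -/
abbrev Sph (m : ℕ) := Metric.sphere (0 : EuclideanSpace ℂ (Fin (m + 1))) 1

/-- The surface measure on `S^{2m+1}`. -/
def sphMeasure (m : ℕ) : Measure (Sph m) :=
  (volume : Measure (EuclideanSpace ℂ (Fin (m + 1)))).toSphere

/-- The operator `I_λ f(ξ) = ∫ f(η) |1-ξ·η̄|^{-λ/2} dσ(η)`. -/
def Ilam (m : ℕ) (lam : ℝ) (f : Sph m → ℝ) (ξ : Sph m) : ℝ :=
  ∫ η : Sph m, f η / ‖(1 : ℂ) - hdot (ξ : EuclideanSpace ℂ (Fin (m + 1))) η‖ ^ (lam / 2)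
    ∂(sphMeasure m)

/-- `L^p` norm (as a real number) with respect to the sphere measure. -/
def spNorm (m : ℕ) (p : ℝ) (f : Sph m → ℝ) : ℝ :=
  (eLpNorm f (ENNReal.ofReal p) (sphMeasure m)).toReal

/-- The CR automorphism `Φ_{t,η}` of the sphere. -/
def Phi {m : ℕ} (t : ℝ) (η ξ : EuclideanSpace ℂ (Fin (m + 1))) :
    EuclideanSpace ℂ (Fin (m + 1)) :=
  ((Real.cosh t : ℂ) + Real.sinh t * hdot ξ η)⁻¹ • (ξ - hdot ξ η • η) +
    (((Real.sinh t : ℂ) + Real.cosh t * hdot ξ η) /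
      ((Real.cosh t : ℂ) + Real.sinh t * hdot ξ η)) • η

/-- The conformal factor `φ_{t,η}(ξ) = |cosh t + (ξ·conj η) sinh t|^{-2}`. -/
def phi {m : ℕ} (t : ℝ) (η ξ : EuclideanSpace ℂ (Fin (m + 1))) : ℝ :=
  (‖(Real.cosh t : ℂ) + hdot ξ η * Real.sinh t‖ ^ 2)⁻¹

/-- `Φ_{t,η}` maps the sphere to itself (as a map of the subtype). -/
def PhiS {m : ℕ} (t : ℝ) (η : EuclideanSpace ℂ (Fin (m + 1))) (hη : ‖η‖ = 1)
    (hS : ∀ ξ : Sph m, ‖Phi t η (ξ : EuclideanSpace ℂ (Fin (m + 1)))‖ = 1)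
    (ξ : Sph m) : Sph m :=
  ⟨Phi t η (ξ : EuclideanSpace ℂ (Fin (m + 1))), by
    simpa [mem_sphere_iff_norm] using hS ξ⟩

/-- Weinstein–Aronszajn identity for a finite-rank perturbation of the identity. -/
lemma LinearMap.det_id_add_sum_smulRight {K E ι : Type*} [Field K] [AddCommGroup E] [Module K E]
    [FiniteDimensional K E] [Fintype ι] [DecidableEq ι] (f : ι → E →ₗ[K] K) (a : ι → E) :
    LinearMap.det (LinearMap.id + ∑ i, (f i).smulRight (a i)) =
      Matrix.det (1 + Matrix.of fun i j => f i (a j)) := by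
  classical
  let b := Module.finBasis K E
  let A : Matrix (Fin (Module.finrank K E)) ι K := Matrix.of fun k i => b.repr (a i) k
  let B : Matrix ι (Fin (Module.finrank K E)) K := Matrix.of fun i k => f i (b k)
  rw [← LinearMap.det_toMatrix b]
  have h1 : LinearMap.toMatrix b b (LinearMap.id + ∑ i, (f i).smulRight (a i)) = 1 + A * B := by
    ext k l
    simp [LinearMap.toMatrix_apply, Matrix.mul_apply, Matrix.one_apply, A, B,
      Finsupp.single_apply, eq_comm, mul_comm]
  have h2 : (Matrix.of fun i j => f i (a j)) = B * A := by
    ext i j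
    conv_lhs => rw [Matrix.of_apply, ← b.sum_repr (a j)]
    simp only [map_sum, map_smul, smul_eq_mul, Matrix.mul_apply, A, B, Matrix.of_apply, mul_comm]
  rw [h1, h2, Matrix.det_one_add_mul_comm]

section
variable {m : ℕ} (t : ℝ) (η x y : EuclideanSpace ℂ (Fin (m + 1)))

lemma hdot_eq_inner : hdot x η = inner ℂ η x := by
  simp [hdot, PiLp.inner_apply]

lemma hdot_add_left : hdot (x + y) η = hdot x η + hdot y η := by
  simp [hdot_eq_inner]

lemma hdot_add_right : hdot η (x + y) = hdot η x + hdot η y := by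
  simp [hdot_eq_inner]

lemma hdot_smul_left (c : ℂ) : hdot (c • x) η = c * hdot x η := by
  simp [hdot_eq_inner]

lemma hdot_smul_right (c : ℂ) : hdot x (c • η) = starRingEnd ℂ c * hdot x η := by
  simp [hdot_eq_inner, mul_comm]

lemma hdot_self : hdot x x = (‖x‖ : ℂ) ^ 2 := by
  rw [hdot_eq_inner, inner_self_eq_norm_sq_to_K]; rfl

lemma conj_hdot : starRingEnd ℂ (hdot x y) = hdot y x := by
  simp [hdot_eq_inner]

lemma real_inner_eq_re_hdot : inner ℝ x y = (hdot y x).re := by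
  simp [hdot, PiLp.inner_apply, Complex.inner]

/-- The denominator of `Phi`, extended to be homogeneous of degree one. -/
def coneDen : ℂ := ‖x‖ * Real.cosh t + Real.sinh t * hdot x η

/-- The numerator of `Phi`, extended to be homogeneous of degree one. -/
def coneNum : EuclideanSpace ℂ (Fin (m + 1)) :=
  x + (((Real.cosh t : ℂ) - 1) * hdot x η + ‖x‖ * Real.sinh t) • η

/-- The extension of `Phi` to a volume-preserving map, homogeneous of degree one. -/
def coneMap : EuclideanSpace ℂ (Fin (m + 1)) :=
  ((‖coneDen t η x‖ : ℂ) / coneDen t η x) • coneNum t η x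

variable {η x}

lemma coneDen_ne_zero (hη : ‖η‖ = 1) (hx : x ≠ 0) : coneDen t η x ≠ 0 := by
  have hr : 0 < ‖x‖ := norm_pos_iff.2 hx
  have hw : ‖hdot x η‖ ≤ ‖x‖ := by
    rw [hdot_eq_inner]; simpa [hη] using norm_inner_le_norm (𝕜 := ℂ) η x
  have hs : |Real.sinh t| < Real.cosh t := by
    rw [Real.abs_sinh, ← Real.cosh_abs t]; exact Real.sinh_lt_cosh _
  intro h
  have h1 : ‖((‖x‖ : ℂ) * Real.cosh t)‖ = ‖(Real.sinh t : ℂ) * hdot x η‖ := by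
    rw [← norm_neg, eq_neg_of_add_eq_zero_left h, neg_neg]
  simp only [norm_mul, Complex.norm_real, Real.norm_eq_abs, abs_norm,
    abs_of_pos (Real.cosh_pos t)] at h1
  nlinarith [norm_nonneg (hdot x η), abs_nonneg (Real.sinh t)]

lemma hdot_coneNum (hη : ‖η‖ = 1) :
    hdot (coneNum t η x) η = Real.cosh t * hdot x η + ‖x‖ * Real.sinh t := by
  rw [coneNum, hdot_add_left, hdot_smul_left, hdot_self, hη]
  push_cast; ring

lemma hdot_coneNum_coneNum (hη : ‖η‖ = 1) :
    hdot (coneNum t η x) (coneNum t η y) =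
      hdot x y - ‖x‖ * ‖y‖ + coneDen t η x * starRingEnd ℂ (coneDen t η y) := by
  simp only [coneNum, coneDen, hdot_add_left, hdot_add_right, hdot_smul_left, hdot_smul_right,
    hdot_self, hη, map_add, map_mul, map_sub, map_one, Complex.conj_ofReal, conj_hdot]
  push_cast
  linear_combination (‖x‖ * ‖y‖ - hdot x η * hdot η y) * (-Complex.cosh_sq (t : ℂ))

lemma norm_coneNum (hη : ‖η‖ = 1) : ‖coneNum t η x‖ = ‖coneDen t η x‖ := by
  have h := hdot_coneNum_coneNum (x := x) t x hη
  rw [hdot_self, hdot_self, Complex.mul_conj, Complex.normSq_eq_norm_sq] at h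
  have h2 : ‖coneNum t η x‖ ^ 2 = ‖coneDen t η x‖ ^ 2 := by
    have : ((‖coneNum t η x‖ : ℂ)) ^ 2 = (‖coneDen t η x‖ : ℂ) ^ 2 := by
      rw [h]; push_cast; ring
    exact_mod_cast this
  exact (sq_eq_sq₀ (norm_nonneg _) (norm_nonneg _)).1 h2

lemma norm_coneMap (hη : ‖η‖ = 1) (hx : x ≠ 0) : ‖coneMap t η x‖ = ‖coneDen t η x‖ := by
  have h0 := norm_ne_zero_iff.2 (coneDen_ne_zero t hη hx)
  rw [coneMap, norm_smul, norm_div, norm_coneNum t hη]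
  simp [h0]

lemma coneMap_ne_zero (hη : ‖η‖ = 1) (hx : x ≠ 0) : coneMap t η x ≠ 0 := by
  rw [← norm_ne_zero_iff, norm_coneMap t hη hx]
  exact norm_ne_zero_iff.2 (coneDen_ne_zero t hη hx)

lemma coneDen_neg_coneMap (hη : ‖η‖ = 1) (hx : x ≠ 0) :
    coneDen (-t) η (coneMap t η x) = ‖coneDen t η x‖ / coneDen t η x * ‖x‖ := by
  have h0 := coneDen_ne_zero t hη hx
  rw [coneDen, norm_coneMap t hη hx, coneMap, hdot_smul_left, hdot_coneNum t hη, Real.cosh_neg,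
    Real.sinh_neg]
  field_simp
  generalize (‖coneDen t η x‖ : ℂ) = N
  rw [coneDen]; push_cast
  linear_combination N * (‖x‖ : ℂ) * Complex.cosh_sq (t : ℂ)

lemma coneNum_neg_coneMap (hη : ‖η‖ = 1) (hx : x ≠ 0) :
    coneNum (-t) η (coneMap t η x) = ((‖coneDen t η x‖ : ℂ) / coneDen t η x) • x := by
  have h0 := coneDen_ne_zero t hη hx
  rw [coneNum, norm_coneMap t hη hx, coneMap, hdot_smul_left, hdot_coneNum t hη, Real.cosh_neg,
    Real.sinh_neg, coneNum, smul_add, smul_smul, add_assoc, ← add_smul]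
  convert add_zero _
  convert zero_smul ℂ _
  field_simp
  generalize (‖coneDen t η x‖ : ℂ) = N
  rw [coneDen]; push_cast
  linear_combination N * hdot x η * Complex.cosh_sq (t : ℂ)

lemma coneMap_neg_coneMap (hη : ‖η‖ = 1) (hx : x ≠ 0) :
    coneMap (-t) η (coneMap t η x) = x := by
  have h0 := coneDen_ne_zero t hη hx
  have h1 : (‖coneDen t η x‖ : ℂ) ≠ 0 := by simpa using h0
  have hr : (‖x‖ : ℂ) ≠ 0 := by simpa using hx
  rw [coneMap, coneNum_neg_coneMap t hη hx, coneDen_neg_coneMap t hη hx, smul_smul]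
  convert one_smul ℂ x
  simp only [norm_mul, norm_div, Complex.norm_real, norm_norm]
  rw [div_self (by simpa using h0)]
  push_cast
  field_simp

lemma coneMap_image (hη : ‖η‖ = 1) : coneMap t η '' {0}ᶜ = {0}ᶜ := by
  ext y
  simp only [Set.mem_image, Set.mem_compl_iff, Set.mem_singleton_iff]
  refine ⟨fun ⟨x, hx, h⟩ => h ▸ coneMap_ne_zero t hη hx, fun hy =>
    ⟨coneMap (-t) η y, coneMap_ne_zero _ hη hy, ?_⟩⟩
  simpa using coneMap_neg_coneMap (-t) hη hy

lemma coneMap_injOn (hη : ‖η‖ = 1) : Set.InjOn (coneMap t η) {0}ᶜ := fun x hx y hy h => by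
  rw [← coneMap_neg_coneMap t hη hx, h, coneMap_neg_coneMap t hη hy]

end

lemma hasFDerivAt_norm_of_ne_zero {F : Type*} [NormedAddCommGroup F] [InnerProductSpace ℝ F]
    {x : F} (hx : x ≠ 0) : HasFDerivAt (fun y : F => ‖y‖) (‖x‖⁻¹ • innerSL ℝ x) x := by
  have h := (hasStrictFDerivAt_norm_sq x).hasFDerivAt.sqrt (pow_ne_zero 2 (norm_ne_zero_iff.2 hx))
  simp only [Real.sqrt_sq (norm_nonneg _)] at h
  convert h using 1
  ext y
  have : ‖x‖ ≠ 0 := norm_ne_zero_iff.2 hx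
  simp
  field_simp

/-- The derivative of the phase `‖z‖ / z`. -/
lemma hasFDerivAt_norm_div {z : ℂ} (hz : z ≠ 0) :
    HasFDerivAt (fun z : ℂ => (‖z‖ : ℂ) / z)
      ((Complex.imCLM.comp (ContinuousLinearMap.mul ℝ ℂ z⁻¹)).smulRight
        (-((‖z‖ : ℂ) / z) * Complex.I)) z := by
  have h1 := (Complex.ofRealCLM.hasFDerivAt (x := ‖z‖)).comp z (hasFDerivAt_norm_of_ne_zero hz)
  have h2 := (hasDerivAt_inv hz).hasFDerivAt.restrictScalars ℝ
  have h3 := h1.mul h2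
  refine HasFDerivAt.congr_fderiv (f := fun z : ℂ => (‖z‖ : ℂ) / z) h3 ?_
  ext h
  have hn : (‖z‖ : ℂ) ≠ 0 := by simpa using hz
  have hzz : (‖z‖ : ℂ) ^ 2 = z * starRingEnd ℂ z := by
    rw [Complex.mul_conj, Complex.normSq_eq_norm_sq]; push_cast; rfl
  have him : (((z⁻¹ * h).im : ℝ) : ℂ) * Complex.I
      = (z⁻¹ * h - starRingEnd ℂ (z⁻¹ * h)) / 2 := by
    rw [Complex.im_eq_sub_conj]; field_simp
  have hre : ((inner ℝ z h : ℝ) : ℂ) = (h * starRingEnd ℂ z + starRingEnd ℂ h * z) / 2 := by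
    rw [Complex.inner, Complex.re_eq_add_conj]; simp [mul_comm]
  have hcz : starRingEnd ℂ z ≠ 0 := by simpa using hz
  have hl : ((z⁻¹ * h).im : ℂ) * (-(‖z‖ / z) * Complex.I) =
      ‖z‖ * (h * -(z ^ 2)⁻¹) + z⁻¹ * (‖z‖⁻¹ * (inner ℝ z h : ℝ)) := by
    rw [hre, show ((z⁻¹ * h).im : ℂ) * (-(‖z‖ / z) * Complex.I) = -(‖z‖ / z) *
      (((z⁻¹ * h).im : ℂ) * Complex.I) by ring, him]
    simp only [map_mul, map_inv₀]
    rw [Complex.ofReal_inv]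
    field_simp
    linear_combination (h * starRingEnd ℂ z + starRingEnd ℂ h * z) * hzz
  refine Eq.trans ?_ (hl.symm.trans ?_)
  · simp [-Complex.inner]
  · simp

section
variable {m : ℕ} (t : ℝ) {η x : EuclideanSpace ℂ (Fin (m + 1))}

/-- The pairing with `η` as a real-linear map. -/
def hdotCLM (η : EuclideanSpace ℂ (Fin (m + 1))) : EuclideanSpace ℂ (Fin (m + 1)) →L[ℝ] ℂ :=
  (innerSL ℂ η).restrictScalars ℝ

lemma hdotCLM_apply : hdotCLM η x = hdot x η := by
  rw [hdot_eq_inner]; rfl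

lemma hasFDerivAt_hdot : HasFDerivAt (fun x => hdot x η) (hdotCLM η) x := by
  simp only [← hdotCLM_apply]
  exact (hdotCLM η).hasFDerivAt

/-- The derivative of `coneDen`. -/
def coneDenDeriv (t : ℝ) (η x : EuclideanSpace ℂ (Fin (m + 1))) :
    EuclideanSpace ℂ (Fin (m + 1)) →L[ℝ] ℂ :=
  (‖x‖⁻¹ • innerSL ℝ x).smulRight (Real.cosh t : ℂ) + (Real.sinh t : ℂ) • hdotCLM η

lemma hasFDerivAt_coneDen (hx : x ≠ 0) :
    HasFDerivAt (coneDen t η) (coneDenDeriv t η x) x := by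
  have h1 := (Complex.ofRealCLM.hasFDerivAt (x := ‖x‖)).comp x (hasFDerivAt_norm_of_ne_zero hx)
  refine HasFDerivAt.congr_fderiv (f := coneDen t η) ((h1.mul_const (Real.cosh t : ℂ)).add
    ((hasFDerivAt_hdot (η := η) (x := x)).const_mul (Real.sinh t : ℂ))) ?_
  ext h
  simp [coneDenDeriv, mul_comm]

/-- The functionals of the rank-three perturbation `coneDeriv`, paired with `coneVec`. -/
def coneFun (t : ℝ) (η x : EuclideanSpace ℂ (Fin (m + 1))) :
    Fin 3 → EuclideanSpace ℂ (Fin (m + 1)) →L[ℝ] ℝ :=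
  ![(Real.cosh t - 1) • Complex.reCLM.comp (hdotCLM η) + Real.sinh t • ‖x‖⁻¹ • innerSL ℝ x,
    (Real.cosh t - 1) • Complex.imCLM.comp (hdotCLM η),
    -((Complex.imCLM.comp (ContinuousLinearMap.mul ℝ ℂ (coneDen t η x)⁻¹)).comp
      (coneDenDeriv t η x))]

/-- The vectors of the rank-three perturbation `coneDeriv`, paired with `coneFun`. -/
def coneVec (t : ℝ) (η x : EuclideanSpace ℂ (Fin (m + 1))) :
    Fin 3 → EuclideanSpace ℂ (Fin (m + 1)) :=
  ![η, Complex.I • η, Complex.I • coneNum t η x]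

/-- The derivative of `coneMap`, up to a phase. -/
def coneDeriv (t : ℝ) (η x : EuclideanSpace ℂ (Fin (m + 1))) :
    EuclideanSpace ℂ (Fin (m + 1)) →L[ℝ] EuclideanSpace ℂ (Fin (m + 1)) :=
  ContinuousLinearMap.id ℝ _ + ∑ i, (coneFun t η x i).smulRight (coneVec t η x i)

lemma hasFDerivAt_coneMap (hη : ‖η‖ = 1) (hx : x ≠ 0) :
    HasFDerivAt (coneMap t η) (((‖coneDen t η x‖ : ℂ) / coneDen t η x) • coneDeriv t η x) x := by
  have h1 := (Complex.ofRealCLM.hasFDerivAt (x := ‖x‖)).comp x (hasFDerivAt_norm_of_ne_zero hx)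
  have hY := (hasFDerivAt_id (𝕜 := ℝ) x).add
    ((((hasFDerivAt_hdot (η := η) (x := x)).const_mul ((Real.cosh t : ℂ) - 1)).add
      (h1.mul_const (Real.sinh t : ℂ))).smul_const η)
  have hu := (hasFDerivAt_norm_div (coneDen_ne_zero t hη hx)).comp x (hasFDerivAt_coneDen t hx)
  have h := hu.smul hY
  refine HasFDerivAt.congr_fderiv (f := coneMap t η) h ?_
  ext1 h
  have hp := Complex.re_add_im (hdotCLM η h)
  simp [coneDeriv, Fin.sum_univ_three, coneFun, coneVec, -Complex.mul_im, -Complex.inv_re,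
    -Complex.inv_im, -Complex.ofReal_cosh, -Complex.ofReal_sinh, ← Complex.coe_smul]
  conv_lhs => rw [← hp]
  simp only [coneNum]
  match_scalars <;> ring

lemma det_coneDeriv (hη : ‖η‖ = 1) (hx : x ≠ 0) :
    LinearMap.det (coneDeriv t η x : EuclideanSpace ℂ (Fin (m + 1)) →ₗ[ℝ] _) = 1 := by
  have h := LinearMap.det_id_add_sum_smulRight
    (fun i => (coneFun t η x i : EuclideanSpace ℂ (Fin (m + 1)) →ₗ[ℝ] ℝ)) (coneVec t η x)
  have h2 : (coneDeriv t η x : EuclideanSpace ℂ (Fin (m + 1)) →ₗ[ℝ] _) = LinearMap.id +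
      ∑ i, (coneFun t η x i : EuclideanSpace ℂ (Fin (m + 1)) →ₗ[ℝ] ℝ).smulRight
        (coneVec t η x i) := by
    ext1 y
    simp [coneDeriv]
  rw [h2, h]
  have hr : ‖x‖ ≠ 0 := norm_ne_zero_iff.2 hx
  have hn : (‖x‖ * Real.cosh t + Real.sinh t * (hdot x η).re) ^ 2 +
      (Real.sinh t * (hdot x η).im) ^ 2 ≠ 0 := by
    have := Complex.normSq_eq_zero.not.2 (coneDen_ne_zero t hη hx)
    contrapose! this
    rw [← this, Complex.normSq_apply]
    simp [coneDen, -Complex.ofReal_cosh, -Complex.ofReal_sinh]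
    ring
  have hD : coneDen t η x = ⟨‖x‖ * Real.cosh t + Real.sinh t * (hdot x η).re,
      Real.sinh t * (hdot x η).im⟩ := by
    apply Complex.ext <;> simp [coneDen, -Complex.ofReal_cosh, -Complex.ofReal_sinh]
  have e1 : hdot η η = 1 := by simp [hdot_self, hη]
  have e2 : (hdot η x).re = (hdot x η).re := by rw [← conj_hdot, Complex.conj_re]
  have e3 : (hdot η x).im = -(hdot x η).im := by rw [← conj_hdot, Complex.conj_im]
  have e4 : (hdot (coneNum t η x) x).im = -(‖x‖ * Real.sinh t * (hdot x η).im) := by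
    rw [coneNum, hdot_add_left, hdot_smul_left, hdot_self, Complex.add_im, ← Complex.ofReal_pow,
      Complex.ofReal_im, Complex.mul_im, e2, e3]
    simp [-Complex.ofReal_cosh, -Complex.ofReal_sinh]
    ring
  have hcs := Real.cosh_sq t
  simp only [Matrix.det_fin_three, coneFun, coneVec, coneDenDeriv]
  simp [hdotCLM_apply, hdot_smul_left, e1, hdot_coneNum t hη, real_inner_eq_re_hdot, e2, e3, e4,
    -Complex.ofReal_cosh, -Complex.ofReal_sinh, hD, Complex.normSq_apply, ← pow_two]
  generalize Real.cosh t = c at *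
  generalize Real.sinh t = s at *
  generalize (hdot x η).re = a at *
  generalize (hdot x η).im = b at *
  generalize ‖x‖ = r at *
  clear * - hr hn hcs
  field_simp
  grind

lemma abs_det_coneMap_deriv (hη : ‖η‖ = 1) (hx : x ≠ 0) :
    |(((‖coneDen t η x‖ : ℂ) / coneDen t η x) • coneDeriv t η x).det| = 1 := by
  have h : ((((‖coneDen t η x‖ : ℂ) / coneDen t η x) • coneDeriv t η x :
      EuclideanSpace ℂ (Fin (m + 1)) →L[ℝ] _) : EuclideanSpace ℂ (Fin (m + 1)) →ₗ[ℝ] _) =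
      (((((‖coneDen t η x‖ : ℂ) / coneDen t η x) • LinearMap.id :
        EuclideanSpace ℂ (Fin (m + 1)) →ₗ[ℂ] _)).restrictScalars ℝ) ∘ₗ
        (coneDeriv t η x : EuclideanSpace ℂ (Fin (m + 1)) →ₗ[ℝ] _) := by
    ext1 y; simp
  have h0 := coneDen_ne_zero t hη hx
  rw [ContinuousLinearMap.det, h, LinearMap.det_comp, det_coneDeriv t hη hx,
    LinearMap.det_restrictScalars]
  simp [Algebra.norm_complex_apply, Complex.normSq_eq_norm_sq, h0]

end

/-- Integral of a cone-shaped truncation of a degree-zero function in polar coordinates. -/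
lemma lintegral_homeomorphUnitSphereProd_truncation {E : Type*} [NormedAddCommGroup E]
    [NormedSpace ℝ E] [FiniteDimensional ℝ E] [Nontrivial E] [MeasurableSpace E] [BorelSpace E]
    (μ : Measure E) [μ.IsAddHaarMeasure] {g : Metric.sphere (0 : E) 1 → ENNReal}
    (hg : Measurable g) {δ : Metric.sphere (0 : E) 1 → ℝ} (hδ : Measurable δ)
    (hδ0 : ∀ u, 0 < δ u) :
    ∫⁻ x : ({0}ᶜ : Set E), (if (homeomorphUnitSphereProd E x).2.1 *
        δ (homeomorphUnitSphereProd E x).1 < 1 then g (homeomorphUnitSphereProd E x).1 else 0) ∂(μ.comap (↑)) =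
      ENNReal.ofReal (Module.finrank ℝ E : ℝ)⁻¹ *
        ∫⁻ u, ENNReal.ofReal ((δ u)⁻¹ ^ Module.finrank ℝ E) * g u ∂μ.toSphere := by
  have hN : 0 < Module.finrank ℝ E := Module.finrank_pos
  have hm : Measurable (fun p : Metric.sphere (0 : E) 1 × Set.Ioi (0 : ℝ) =>
      if p.2.1 * δ p.1 < 1 then g p.1 else 0) :=
    Measurable.ite (measurableSet_lt (by fun_prop) measurable_const) (by fun_prop) measurable_const
  rw [(μ.measurePreserving_homeomorphUnitSphereProd).lintegral_comp_emb
    (Homeomorph.measurableEmbedding _) (fun p : Metric.sphere (0 : E) 1 × Set.Ioi (0 : ℝ) =>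
      if p.2.1 * δ p.1 < 1 then g p.1 else 0), lintegral_prod _ hm.aemeasurable,
    ← lintegral_const_mul' _ _ ENNReal.ofReal_ne_top]
  refine lintegral_congr fun u => ?_
  have hd : 0 < (δ u)⁻¹ := inv_pos.2 (hδ0 u)
  have h1 : (fun r : Set.Ioi (0 : ℝ) => if r.1 * δ u < 1 then g u else 0) =
      (Set.Iio (⟨(δ u)⁻¹, hd⟩ : Set.Ioi (0 : ℝ))).indicator fun _ => g u := by
    ext r
    have : r.1 * δ u < 1 ↔ r < (⟨(δ u)⁻¹, hd⟩ : Set.Ioi (0 : ℝ)) := by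
      rw [← Subtype.coe_lt_coe, lt_inv_comm₀ r.2 (hδ0 u), lt_inv_comm₀ (hδ0 u) r.2,
        ← one_div, lt_div_iff₀ (hδ0 u)]
    simp [Set.indicator_apply, this]
  simp only [h1]
  rw [lintegral_indicator_const measurableSet_Iio, Measure.volumeIoiPow_apply_Iio,
    Nat.sub_add_cancel hN, Nat.cast_pred hN, sub_add_cancel, ← mul_assoc, ← ENNReal.ofReal_mul
    (by positivity), mul_comm, div_eq_inv_mul]

section
variable {m : ℕ} (t : ℝ) {η : EuclideanSpace ℂ (Fin (m + 1))}

instance : (volume : Measure (EuclideanSpace ℂ (Fin (m + 1)))).IsAddHaarMeasure :=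
  inferInstanceAs (Module.finBasis ℝ (EuclideanSpace ℂ (Fin (m + 1)))).addHaar.IsAddHaarMeasure

lemma ne_zero_of_mem_sph (u : Sph m) : (u : EuclideanSpace ℂ (Fin (m + 1))) ≠ 0 :=
  ne_zero_of_mem_unit_sphere u

lemma norm_sph (u : Sph m) : ‖(u : EuclideanSpace ℂ (Fin (m + 1)))‖ = 1 :=
  norm_eq_of_mem_sphere u

lemma continuous_coneDen : Continuous (coneDen t η) := by
  unfold coneDen
  simp only [← hdotCLM_apply]
  fun_prop

lemma continuous_coneNum : Continuous (coneNum t η) := by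
  unfold coneNum
  simp only [← hdotCLM_apply]
  fun_prop

lemma Phi_eq_coneNum (u : Sph m) :
    Phi t η u = (coneDen t η u)⁻¹ • coneNum t η (u : EuclideanSpace ℂ (Fin (m + 1))) := by
  simp only [Phi, coneDen, coneNum, norm_sph, Complex.ofReal_one, one_mul]
  match_scalars <;> ring

lemma phi_eq_coneDen (u : Sph m) :
    phi t η u = (‖coneDen t η (u : EuclideanSpace ℂ (Fin (m + 1)))‖ ^ 2)⁻¹ := by
  simp [phi, coneDen, mul_comm]

lemma coneDen_smul {r : ℝ} (hr : 0 < r) (x : EuclideanSpace ℂ (Fin (m + 1))) :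
    coneDen t η (r • x) = r * coneDen t η x := by
  rw [← Complex.coe_smul, coneDen, coneDen, hdot_smul_left, norm_smul, Complex.norm_real,
    Real.norm_of_nonneg hr.le]
  push_cast; ring

lemma coneNum_smul {r : ℝ} (hr : 0 < r) (x : EuclideanSpace ℂ (Fin (m + 1))) :
    coneNum t η (r • x) = (r : ℂ) • coneNum t η x := by
  rw [← Complex.coe_smul, coneNum, coneNum, hdot_smul_left, norm_smul, Complex.norm_real,
    Real.norm_of_nonneg hr.le]
  push_cast
  match_scalars <;> ring

lemma coneMap_smul_sph (hη : ‖η‖ = 1) {r : ℝ} (hr : 0 < r) (u : Sph m) :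
    coneMap t η (r • (u : EuclideanSpace ℂ (Fin (m + 1)))) =
      (r * ‖coneDen t η (u : EuclideanSpace ℂ (Fin (m + 1)))‖) • Phi t η u := by
  have h0 := coneDen_ne_zero t hη (ne_zero_of_mem_sph u)
  have hr' : (r : ℂ) ≠ 0 := by exact_mod_cast hr.ne'
  rw [coneMap, coneDen_smul t hr, coneNum_smul t hr, Phi_eq_coneNum, ← Complex.coe_smul,
    smul_smul, smul_smul, norm_mul, Complex.norm_real, Real.norm_of_nonneg hr.le]
  congr 1
  push_cast
  field_simp

variable (hη : ‖η‖ = 1)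
  (hS : ∀ ξ : Sph m, ‖Phi t η (ξ : EuclideanSpace ℂ (Fin (m + 1)))‖ = 1)

lemma continuous_PhiS : Continuous (PhiS t η hη hS) := by
  refine Continuous.subtype_mk ?_ _
  simp only [Phi_eq_coneNum]
  exact (((continuous_coneDen t).comp continuous_subtype_val).inv₀ fun u =>
    coneDen_ne_zero t hη (ne_zero_of_mem_sph u)).smul
      ((continuous_coneNum t).comp continuous_subtype_val)

lemma homeomorphUnitSphereProd_coneMap (x : ({0}ᶜ : Set (EuclideanSpace ℂ (Fin (m + 1)))))
    (hx : coneMap t η x ∈ ({0}ᶜ : Set (EuclideanSpace ℂ (Fin (m + 1))))) :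
    homeomorphUnitSphereProd _ ⟨coneMap t η x, hx⟩ =
      (PhiS t η hη hS (homeomorphUnitSphereProd _ x).1,
        ⟨(homeomorphUnitSphereProd _ x).2.1 * ‖coneDen t η
          ((homeomorphUnitSphereProd _ x).1 : EuclideanSpace ℂ (Fin (m + 1)))‖,
          mul_pos (homeomorphUnitSphereProd _ x).2.2
            (norm_pos_iff.2 (coneDen_ne_zero t hη (ne_zero_of_mem_sph _)))⟩) := by
  obtain ⟨⟨u, r⟩, rfl⟩ := (homeomorphUnitSphereProd _).symm.surjective x
  apply (homeomorphUnitSphereProd _).symm.injective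
  rw [Homeomorph.symm_apply_apply]
  ext1
  simp only [homeomorphUnitSphereProd_symm_apply_coe, Homeomorph.apply_symm_apply]
  exact coneMap_smul_sph t hη r.2 u

lemma PhiS_injective : Function.Injective (PhiS t η hη hS) := by
  intro u v h
  have hpos (u : Sph m) : 0 < ‖coneDen t η (u : EuclideanSpace ℂ (Fin (m + 1)))‖⁻¹ :=
    inv_pos.2 (norm_pos_iff.2 (coneDen_ne_zero t hη (ne_zero_of_mem_sph u)))
  have hmem (u : Sph m) : ‖coneDen t η (u : EuclideanSpace ℂ (Fin (m + 1)))‖⁻¹ •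
      (u : EuclideanSpace ℂ (Fin (m + 1))) ∈ ({0}ᶜ : Set (EuclideanSpace ℂ (Fin (m + 1)))) :=
    smul_ne_zero (hpos u).ne' (ne_zero_of_mem_sph u)
  have huv := coneMap_injOn t hη (hmem u) (hmem v) (by
    rw [coneMap_smul_sph t hη (hpos u), coneMap_smul_sph t hη (hpos v),
      inv_mul_cancel₀ (inv_pos.1 (hpos u)).ne', inv_mul_cancel₀ (inv_pos.1 (hpos v)).ne',
      one_smul, one_smul]
    exact congrArg Subtype.val h)
  have hn := congrArg norm huv
  rw [norm_smul, norm_smul, norm_sph, norm_sph, mul_one, mul_one,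
    Real.norm_of_nonneg (hpos u).le, Real.norm_of_nonneg (hpos v).le] at hn
  rw [hn] at huv
  exact Subtype.ext (smul_right_injective _ (hpos v).ne' huv)

lemma finrank_euclideanSpace_complex :
    Module.finrank ℝ (EuclideanSpace ℂ (Fin (m + 1))) = 2 * (m + 1) := by
  rw [← Module.finrank_mul_finrank ℝ ℂ, Complex.finrank_real_complex, finrank_euclideanSpace_fin]

lemma lintegral_sphMeasure_comp_PhiS {g : Sph m → ENNReal} (hg : Measurable g) :
    ∫⁻ u, ENNReal.ofReal (phi t η (u : EuclideanSpace ℂ (Fin (m + 1))) ^ (m + 1)) *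
      g (PhiS t η hη hS u) ∂sphMeasure m = ∫⁻ u, g u ∂sphMeasure m := by
  classical
  have hδ : Measurable fun u : Sph m => ‖coneDen t η (u : EuclideanSpace ℂ (Fin (m + 1)))‖ :=
    ((continuous_coneDen t).comp continuous_subtype_val).norm.measurable
  have h1 := lintegral_homeomorphUnitSphereProd_truncation
    (volume : Measure (EuclideanSpace ℂ (Fin (m + 1)))) hg
    (δ := fun _ => 1) measurable_const (fun _ => one_pos)
  have h2 := lintegral_homeomorphUnitSphereProd_truncation
    (volume : Measure (EuclideanSpace ℂ (Fin (m + 1))))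
    (hg.comp (continuous_PhiS t hη hS).measurable) hδ
    (fun u => norm_pos_iff.2 (coneDen_ne_zero t hη (ne_zero_of_mem_sph u)))
  let F : EuclideanSpace ℂ (Fin (m + 1)) → ENNReal := fun x =>
    if hx : x ∈ ({0}ᶜ : Set (EuclideanSpace ℂ (Fin (m + 1)))) then
    if (homeomorphUnitSphereProd _ ⟨x, hx⟩).2.1 * 1 < 1 then
      g (homeomorphUnitSphereProd _ ⟨x, hx⟩).1 else 0 else 0
  have hs : MeasurableSet ({0}ᶜ : Set (EuclideanSpace ℂ (Fin (m + 1)))) :=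
    (measurableSet_singleton 0).compl
  have hF := lintegral_image_eq_lintegral_abs_det_fderiv_mul volume hs
    (fun x hx => (hasFDerivAt_coneMap t hη hx).hasFDerivWithinAt) (coneMap_injOn t hη) F
  rw [coneMap_image t hη, ← lintegral_subtype_comap hs, ← lintegral_subtype_comap hs] at hF
  have h3 : ∀ x : ({0}ᶜ : Set (EuclideanSpace ℂ (Fin (m + 1)))), F x =
      if (homeomorphUnitSphereProd _ x).2.1 * 1 < 1 then
      g (homeomorphUnitSphereProd _ x).1 else 0 := fun x => dif_pos x.2
  have h4 : ∀ x : ({0}ᶜ : Set (EuclideanSpace ℂ (Fin (m + 1)))), ENNReal.ofReal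
      |(((‖coneDen t η (x : EuclideanSpace ℂ (Fin (m + 1)))‖ : ℂ) /
        coneDen t η (x : EuclideanSpace ℂ (Fin (m + 1)))) •
          coneDeriv t η (x : EuclideanSpace ℂ (Fin (m + 1)))).det| *
        F (coneMap t η x) = if (homeomorphUnitSphereProd _ x).2.1 *
          ‖coneDen t η ((homeomorphUnitSphereProd _ x).1 : EuclideanSpace ℂ (Fin (m + 1)))‖ < 1 then
      (g ∘ PhiS t η hη hS) (homeomorphUnitSphereProd _ x).1 else 0 := fun x => by
    have hx : coneMap t η x ∈ ({0}ᶜ : Set (EuclideanSpace ℂ (Fin (m + 1)))) :=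
      coneMap_ne_zero t hη x.2
    rw [abs_det_coneMap_deriv t hη x.2, ENNReal.ofReal_one, one_mul,
      h3 ⟨_, hx⟩, homeomorphUnitSphereProd_coneMap t hη hS x hx, mul_one]
    rfl
  simp only [h3, h4] at hF
  rw [h1, h2, ENNReal.mul_right_inj] at hF
  · rw [sphMeasure]
    simp only [inv_one, one_pow, ENNReal.ofReal_one, one_mul] at hF
    rw [hF]
    refine lintegral_congr fun u => ?_
    rw [phi_eq_coneDen, finrank_euclideanSpace_complex, pow_mul]
    simp only [inv_pow, Function.comp_apply]
  · have : 0 < Module.finrank ℝ (EuclideanSpace ℂ (Fin (m + 1))) := Module.finrank_pos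
    simpa using this.ne'
  · exact ENNReal.ofReal_ne_top

lemma integral_sphMeasure_comp_PhiS (F : Sph m → ℝ) :
    ∫ u, F u ∂sphMeasure m = ∫ u, phi t η (u : EuclideanSpace ℂ (Fin (m + 1))) ^ (m + 1) *
      F (PhiS t η hη hS u) ∂sphMeasure m := by
  have hc : Measurable fun u : Sph m =>
      ENNReal.ofReal (phi t η (u : EuclideanSpace ℂ (Fin (m + 1))) ^ (m + 1)) := by
    simp only [phi_eq_coneDen]
    have := ((continuous_coneDen (m := m) (η := η) t).comp continuous_subtype_val).measurable
      (α := Sph m)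
    simp only [Function.comp_def] at this
    fun_prop
  have hcont := continuous_PhiS t hη hS
  have hmap : ((sphMeasure m).withDensity fun u : Sph m =>
      ENNReal.ofReal (phi t η (u : EuclideanSpace ℂ (Fin (m + 1))) ^ (m + 1))).map
      (PhiS t η hη hS) = sphMeasure m := by
    ext s hs
    rw [Measure.map_apply hcont.measurable hs, withDensity_apply _ (hcont.measurable hs),
      ← lintegral_indicator_one hs, ← lintegral_sphMeasure_comp_PhiS t hη hS
        (measurable_one.indicator hs), ← lintegral_indicator (hcont.measurable hs)]
    refine lintegral_congr fun u => ?_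
    by_cases h : PhiS t η hη hS u ∈ s <;> simp [Set.indicator, h]
  have hemb : MeasurableEmbedding (PhiS t η hη hS) :=
    (hcont.isClosedEmbedding (PhiS_injective t hη hS)).measurableEmbedding
  conv_lhs => rw [← hmap]
  rw [hemb.integral_map, integral_withDensity_eq_integral_toReal_smul hc
    (Filter.Eventually.of_forall fun _ => ENNReal.ofReal_lt_top)]
  refine integral_congr_ae (Filter.Eventually.of_forall fun u => ?_)
  have : 0 ≤ phi t η (u : EuclideanSpace ℂ (Fin (m + 1))) := by rw [phi]; positivity
  simp [ENNReal.toReal_ofReal (pow_nonneg this _)]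

end

section
variable {m : ℕ} (t : ℝ) {η : EuclideanSpace ℂ (Fin (m + 1))}

lemma phi_pos (hη : ‖η‖ = 1) (u : Sph m) : 0 < phi t η (u : EuclideanSpace ℂ (Fin (m + 1))) := by
  have := norm_pos_iff.2 (coneDen_ne_zero t hη (ne_zero_of_mem_sph u))
  rw [phi_eq_coneDen]
  positivity

lemma phi_neg_Phi (hη : ‖η‖ = 1) (u : Sph m) :
    phi t (-η) (Phi t η u) = (phi t η (u : EuclideanSpace ℂ (Fin (m + 1))))⁻¹ := by
  have h0 := coneDen_ne_zero t hη (ne_zero_of_mem_sph u)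
  have hneg (z : EuclideanSpace ℂ (Fin (m + 1))) : hdot z (-η) = -hdot z η := by simp [hdot]
  have hcs : (Real.cosh t : ℂ) ^ 2 = Real.sinh t ^ 2 + 1 := by exact_mod_cast Real.cosh_sq t
  have h : (Real.cosh t : ℂ) + hdot (Phi t η u) (-η) * Real.sinh t =
      (coneDen t η (u : EuclideanSpace ℂ (Fin (m + 1))))⁻¹ := by
    rw [hneg, Phi_eq_coneNum, hdot_smul_left, hdot_coneNum t hη]
    field_simp
    rw [coneDen, norm_sph]
    push_cast at hcs ⊢
    linear_combination hcs
  rw [phi_eq_coneDen, phi, h, norm_inv, inv_pow]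

lemma one_sub_hdot_Phi (hη : ‖η‖ = 1) (u v : Sph m) :
    1 - hdot (Phi t η u) (Phi t η v) =
      (1 - hdot (u : EuclideanSpace ℂ (Fin (m + 1))) v) *
        (coneDen t η (u : EuclideanSpace ℂ (Fin (m + 1))))⁻¹ *
        starRingEnd ℂ (coneDen t η (v : EuclideanSpace ℂ (Fin (m + 1))))⁻¹ := by
  have hu := coneDen_ne_zero t hη (ne_zero_of_mem_sph u)
  have hv := (map_ne_zero (starRingEnd ℂ)).2 (coneDen_ne_zero t hη (ne_zero_of_mem_sph v))
  rw [Phi_eq_coneNum, Phi_eq_coneNum, hdot_smul_left, hdot_smul_right,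
    hdot_coneNum_coneNum t _ hη, norm_sph, norm_sph, map_inv₀]
  field_simp
  push_cast
  ring

lemma norm_one_sub_hdot_Phi_rpow (hη : ‖η‖ = 1) (u v : Sph m) (a : ℝ) :
    ‖1 - hdot (Phi t η u) (Phi t η v)‖ ^ a =
      ‖1 - hdot (u : EuclideanSpace ℂ (Fin (m + 1))) v‖ ^ a *
        phi t η (u : EuclideanSpace ℂ (Fin (m + 1))) ^ (a / 2) *
        phi t η (v : EuclideanSpace ℂ (Fin (m + 1))) ^ (a / 2) := by
  have h (w : Sph m) : ‖coneDen t η (w : EuclideanSpace ℂ (Fin (m + 1)))‖⁻¹ ^ a =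
      phi t η (w : EuclideanSpace ℂ (Fin (m + 1))) ^ (a / 2) := by
    rw [phi_eq_coneDen, ← inv_pow, ← Real.rpow_natCast, ← Real.rpow_mul (by positivity)]
    congr 1
    push_cast
    ring
  rw [one_sub_hdot_Phi t hη, norm_mul, norm_mul, RCLike.norm_conj, norm_inv, norm_inv,
    Real.mul_rpow (by positivity) (by positivity), Real.mul_rpow (by positivity) (by positivity),
    h, h]

end

theorem Ilam_conformal_transform {m : ℕ} (hm : 1 ≤ m) (t : ℝ) (ht : 0 ≤ t)
    (η : EuclideanSpace ℂ (Fin (m + 1))) (hη : ‖η‖ = 1)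
    (hS : ∀ ξ : Sph m, ‖Phi t η (ξ : EuclideanSpace ℂ (Fin (m + 1)))‖ = 1)
    (lam : ℝ) (hlam0 : 0 < lam) (hlam1 : lam < 2 * (m + 1))
    (p : ℝ) (hp1 : 1 < p)
    (f : Sph m → ℝ) (hf : Integrable f (sphMeasure m)) (ξ : Sph m) :
    Ilam m lam
        (fun ζ => f (PhiS t η hη hS ζ) *
          phi t η (ζ : EuclideanSpace ℂ (Fin (m + 1))) ^ ((m + 1 : ℝ) / p)) ξ =
      Ilam m lam
          (fun ζ => f ζ *
            phi t (-η) (ζ : EuclideanSpace ℂ (Fin (m + 1))) ^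
              ((m + 1 : ℝ) / (p / (p - 1)) - lam / 4))
          (PhiS t η hη hS ξ) *
        phi t η (ξ : EuclideanSpace ℂ (Fin (m + 1))) ^ (lam / 4) := by
  simp only [Ilam]
  rw [integral_sphMeasure_comp_PhiS t hη hS (fun ζ : Sph m => f ζ *
    phi t (-η) (ζ : EuclideanSpace ℂ (Fin (m + 1))) ^ ((m + 1 : ℝ) / (p / (p - 1)) - lam / 4) /
      ‖(1 : ℂ) - hdot (PhiS t η hη hS ξ : EuclideanSpace ℂ (Fin (m + 1))) ζ‖ ^ (lam / 2)),
    ← integral_mul_const]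
  refine integral_congr_ae (Filter.Eventually.of_forall fun ζ => ?_)
  have hp0 : p ≠ 0 := by positivity
  have hξ := phi_pos t hη ξ
  have hζ := phi_pos t hη ζ
  simp only [PhiS, phi_neg_Phi t hη, norm_one_sub_hdot_Phi_rpow t hη,
    show lam / 2 / 2 = lam / 4 by ring, Real.inv_rpow hζ.le, ← Real.rpow_neg hζ.le]
  have hexp : (m + 1 : ℝ) / p = ((m + 1 : ℕ) : ℝ) + -((m + 1 : ℝ) / (p / (p - 1)) - lam / 4)
      - lam / 4 := by
    push_cast
    field_simp
    ring
  rw [hexp, Real.rpow_sub hζ, Real.rpow_add hζ, Real.rpow_natCast]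
  have h1 := (Real.rpow_pos_of_pos hξ (lam / 4)).ne'
  have h2 := (Real.rpow_pos_of_pos hζ (lam / 4)).ne'
  field_simp
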